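/- Let N be a CPN, δ a partition of N, and t∈T a transition. If there exist markings M₁,M₂ of N such that M₁ ≡δ M₂, M₁ can fire t, and M₂ cannot fire t, then there exist markings M₃,M₄ in the set M^bounded(N) of bounded markings such that M₃ ≡δ M₄, M₃ can fire t, and M₄ cannot fire t. -/

import Mathlib

/- Formalization of colored Petri nets (CPN) following the paper's definitions. -/

noncomputable section
attribute [local instance] Classical.propDecidable
attribute [local instance] Classical.decEq

/-- A colored Petri net `N = (P,T,ℂ,𝔹,C,G,W,W_I,M₀)`:
`dom` is the place color type function `C`, `guard` the guard evaluation `G`,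
`pre`/`post` the arc evaluation `W` for place-to-transition and transition-to-place arcs,
`inhib` the inhibitor arc weight `W_I` (with `⊤` meaning no inhibitor arc),
and `M0` the initial marking. -/
structure CPN (P T C B : Type) where
  dom : P → Set C
  guard : T → B → Prop
  pre : P → T → B → Multiset C
  post : T → P → B → Multiset C
  inhib : P → T → ℕ∞
  M0 : P → Multiset C

variable {P T C B : Type}

/-- Well-formedness conditions from the definition of a CPN: color domains are nonempty,
arc expressions only use colors from the color domain of the connected place, inhibitor
weights are positive, and the initial marking is a marking. -/
def CPN.WF (N : CPN P T C B) : Prop :=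
  (∀ p, (N.dom p).Nonempty) ∧
  (∀ p t b, ∀ c ∈ N.pre p t b, c ∈ N.dom p) ∧
  (∀ p t b, ∀ c ∈ N.post t p b, c ∈ N.dom p) ∧
  (∀ p t, 0 < N.inhib p t) ∧
  (∀ p, ∀ c ∈ N.M0 p, c ∈ N.dom p)

/-- `M` is a marking of `N`: `set(M(p)) ⊆ C(p)` for all places `p`. -/
def CPN.IsMk (N : CPN P T C B) (M : P → Multiset C) : Prop :=
  ∀ p, ∀ c ∈ M p, c ∈ N.dom p

/-- Transition firing `M →t M'`: there is a binding `b` satisfying the guard such that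
`W((p,t),b) ⊆ M(p)` and `W_I(p,t) > |M(p)|` for all `p`, and
`M'(p) = (M(p) ∖ W((p,t),b)) ⊎ W((t,p),b)` for all `p`. -/
def CPN.Fires (N : CPN P T C B) (M : P → Multiset C) (t : T) (M' : P → Multiset C) : Prop :=
  ∃ b, N.guard t b ∧
    (∀ p, N.pre p t b ≤ M p) ∧
    (∀ p, ((M p).card : ℕ∞) < N.inhib p t) ∧
    (∀ p, M' p = M p - N.pre p t b + N.post t p b)

/-- `Σ_{c∈θ} S(c)`: the number of elements of the multiset `S` whose color lies in `θ`. -/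
def countIn (S : Multiset C) (θ : Set C) : ℕ := (S.filter (· ∈ θ)).card

/-- `M ≡δ M'` iff for all `p ∈ P` and all `θ ∈ δ(p)`, `Σ_{c∈θ}M(p)(c) = Σ_{c∈θ}M'(p)(c)`. -/
def MarkEquiv (δ : P → Set (Set C)) (M M' : P → Multiset C) : Prop :=
  ∀ p, ∀ θ ∈ δ p, countIn (M p) θ = countIn (M' p) θ

/-- `δ` is a partition of `N`: for each place `p`, the equivalence classes in `δ(p)` are
nonempty, pairwise disjoint, and their union is `C(p)`. -/
def CPN.IsPartition (N : CPN P T C B) (δ : P → Set (Set C)) : Prop :=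
  ∀ p, ∅ ∉ δ p ∧ ⋃₀ δ p = N.dom p ∧
    ∀ θ₁ ∈ δ p, ∀ θ₂ ∈ δ p, θ₁ ≠ θ₂ → θ₁ ∩ θ₂ = ∅

/-- `δ` is stable: the relation `≡δ` on markings of `N` is a bisimulation on the LTS of `N`
labeled by transition names (stated for one direction; the other follows by symmetry of `≡δ`). -/
def CPN.IsStable (N : CPN P T C B) (δ : P → Set (Set C)) : Prop :=
  ∀ M₁ M₂, N.IsMk M₁ → N.IsMk M₂ → MarkEquiv δ M₁ M₂ →
    ∀ t M₁', N.Fires M₁ t M₁' → ∃ M₂', N.Fires M₂ t M₂' ∧ MarkEquiv δ M₁' M₂'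

/-- The maximum arc size `max(N) = max_{p,t,b}(|W((p,t),b)|, |W((t,p),b)|)`. -/
def CPN.maxArc (N : CPN P T C B) [Fintype P] [Fintype T] [Fintype B] : ℕ :=
  Finset.univ.sup fun x : P × T × B =>
    max (N.pre x.1 x.2.1 x.2.2).card (N.post x.2.1 x.1 x.2.2).card

/-- `M` is bounded: `|M(p)| ≤ max(N)` for all `p`; together with `IsMk` this says
`M ∈ M^bounded(N)`. -/
def CPN.Bounded (N : CPN P T C B) [Fintype P] [Fintype T] [Fintype B]
    (M : P → Multiset C) : Prop :=
  ∀ p, (M p).card ≤ N.maxArc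

theorem countIn_cons (c : C) (S : Multiset C) (θ : Set C) :
    countIn (c ::ₘ S) θ = countIn S θ + if c ∈ θ then 1 else 0 := by
  unfold countIn
  split_ifs with h <;> simp [h]

theorem countIn_pos {S : Multiset C} {θ : Set C} : 0 < countIn S θ ↔ ∃ c ∈ S, c ∈ θ := by
  simp [countIn, Multiset.card_pos_iff_exists_mem]

/-- Two colors lie in the same classes of `D`. -/
def SameClass (D : Set (Set C)) (x y : C) : Prop := ∀ θ ∈ D, x ∈ θ ↔ y ∈ θ

theorem countIn_eq_of_rel {D : Set (Set C)} {S S' : Multiset C}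
    (h : Multiset.Rel (SameClass D) S S') {θ : Set C} (hθ : θ ∈ D) :
    countIn S θ = countIn S' θ := by
  induction h with
  | zero => rfl
  | cons hab _ ih => simp only [countIn_cons, ih, hab θ hθ]

/-- Multisets of covered colors with equal class counts can be matched class by class. -/
theorem rel_of_countIn_eq {D : Set (Set C)}
    (hD : ∀ θ₁ ∈ D, ∀ θ₂ ∈ D, θ₁ ≠ θ₂ → θ₁ ∩ θ₂ = ∅) {S S' : Multiset C}
    (hS : ∀ c ∈ S, c ∈ ⋃₀ D) (hS' : ∀ c ∈ S', c ∈ ⋃₀ D)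
    (h : ∀ θ ∈ D, countIn S θ = countIn S' θ) : Multiset.Rel (SameClass D) S S' := by
  have huniq : ∀ θ₁ ∈ D, ∀ θ₂ ∈ D, ∀ c, c ∈ θ₁ → c ∈ θ₂ → θ₁ = θ₂ := by
    intro θ₁ h₁ θ₂ h₂ c hc₁ hc₂
    by_contra hne
    exact Set.eq_empty_iff_forall_notMem.mp (hD θ₁ h₁ θ₂ h₂ hne) c ⟨hc₁, hc₂⟩
  induction S using Multiset.induction generalizing S' with
  | empty =>
    rw [Multiset.rel_zero_left]
    refine Multiset.eq_zero_of_forall_notMem fun c hc => ?_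
    obtain ⟨θ, hθ, hcθ⟩ := hS' c hc
    have hpos := countIn_pos.mpr ⟨c, hc, hcθ⟩
    rw [← h θ hθ] at hpos
    simp [countIn] at hpos
  | cons a S ih =>
    obtain ⟨θ, hθ, haθ⟩ := hS a (Multiset.mem_cons_self a S)
    have hpos := countIn_pos.mpr ⟨a, Multiset.mem_cons_self a S, haθ⟩
    rw [h θ hθ] at hpos
    obtain ⟨b, hb, hbθ⟩ := countIn_pos.mp hpos
    obtain ⟨S', rfl⟩ := Multiset.exists_cons_of_mem hb
    have hab : SameClass D a b := fun θ' hθ' =>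
      ⟨fun ha => huniq θ hθ θ' hθ' a haθ ha ▸ hbθ, fun hb => huniq θ hθ θ' hθ' b hbθ hb ▸ haθ⟩
    refine Multiset.Rel.cons hab (ih (fun c hc => hS c (Multiset.mem_cons_of_mem hc))
      (fun c hc => hS' c (Multiset.mem_cons_of_mem hc)) fun θ' hθ' => ?_)
    have hcount := h θ' hθ'
    simp only [countIn_cons, hab θ' hθ'] at hcount
    exact Nat.add_right_cancel hcount

theorem exists_le_rel_of_le {r : C → C → Prop} {A S S' : Multiset C} (hA : A ≤ S)
    (h : Multiset.Rel r S S') : ∃ A' ≤ S', Multiset.Rel r A A' := by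
  obtain ⟨X, rfl⟩ := Multiset.le_iff_exists_add.mp hA
  obtain ⟨A', X', hAA', -, rfl⟩ := Multiset.rel_add_left.mp h
  exact ⟨A', Multiset.le_add_right A' X', hAA'⟩

theorem CPN.card_pre_le_maxArc (N : CPN P T C B) [Fintype P] [Fintype T] [Fintype B]
    (p : P) (t : T) (b : B) : (N.pre p t b).card ≤ N.maxArc :=
  (le_max_left _ _).trans
    (Finset.le_sup (f := fun x : P × T × B =>
      max (N.pre x.1 x.2.1 x.2.2).card (N.post x.2.1 x.1 x.2.2).card) (Finset.mem_univ (p, t, b)))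

/-- Lemma 8(a). If there are markings `M₁ ≡δ M₂` of `N` with `M₁` able to
fire `t` and `M₂` unable to fire `t`, then there are bounded markings `M₃ ≡δ M₄` in
`M^bounded(N)` with `M₃` able to fire `t` and `M₄` unable to fire `t`. -/
theorem bounded_witness_enabledness [Fintype P] [Fintype T] [Fintype B]
    (N : CPN P T C B) (hWF : N.WF) (δ : P → Set (Set C)) (hpart : N.IsPartition δ) (t : T)
    (M₁ M₂ : P → Multiset C) (h₁ : N.IsMk M₁) (h₂ : N.IsMk M₂)
    (heq : MarkEquiv δ M₁ M₂) (hfire : ∃ M', N.Fires M₁ t M')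
    (hnofire : ¬ ∃ M', N.Fires M₂ t M') :
    ∃ M₃ M₄ : P → Multiset C, N.IsMk M₃ ∧ N.IsMk M₄ ∧ N.Bounded M₃ ∧ N.Bounded M₄ ∧
      MarkEquiv δ M₃ M₄ ∧ (∃ M', N.Fires M₃ t M') ∧ ¬ ∃ M', N.Fires M₄ t M' := by
  obtain ⟨-, b, hg, hpre, hinh, -⟩ := hfire
  have hrel : ∀ p, Multiset.Rel (SameClass (δ p)) (M₁ p) (M₂ p) := fun p => by
    obtain ⟨-, hU, hD⟩ := hpart p
    exact rel_of_countIn_eq hD (hU ▸ h₁ p) (hU ▸ h₂ p) (heq p)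
  choose M₄ hle hM₄ using fun p => exists_le_rel_of_le (hpre p) (hrel p)
  refine ⟨fun p => N.pre p t b, M₄, fun p => hWF.2.1 p t b,
    fun p c hc => h₂ p c (Multiset.mem_of_le (hle p) hc),
    fun p => N.card_pre_le_maxArc p t b,
    fun p => (Multiset.card_eq_card_of_rel (hM₄ p)).symm.trans_le (N.card_pre_le_maxArc p t b),
    fun p θ hθ => countIn_eq_of_rel (hM₄ p) hθ,
    ⟨_, b, hg, fun p => le_rfl, fun p => lt_of_le_of_lt ?_ (hinh p), fun p => rfl⟩, ?_⟩
  · exact_mod_cast Multiset.card_le_card (hpre p)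
  · rintro ⟨-, b', hg', hpre', -, -⟩
    refine hnofire ⟨_, b', hg', fun p => (hpre' p).trans (hle p), fun p => ?_, fun p => rfl⟩
    rw [← Multiset.card_eq_card_of_rel (hrel p)]
    exact hinh p

end
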